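/- arXiv:2501.06766 — 7 statements merged into one kernel-verified Lean document; each statement's English description precedes it below -/
import Mathlib

section
/- Let M be an n-feature classifier, c ∈ {0,1} a class, and φ ∈ L_n a global necessary reason for c w.r.t. M. Then φ is not ⊆-minimal if and only if there exists a literal ℓ over n features such that φ ⊭ ℓ and ℓ (viewed as a one-literal condition) is a global necessary reason for c w.r.t. M. -/
/-- An n-instance: a binary vector of length n. -/
abbrev Inst (n : ℕ) := Fin n → Bool

/-- Terms: constants 0/1 or feature variables v_i. -/
inductive Term (n : ℕ) : Type where
  | const : Bool → Term n
  | var : Fin n → Term n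
  deriving DecidableEq

/-- A literal t ◊ t' with ◊ ∈ {=, ≠} (isEq = true means `=`). -/
structure Lit (n : ℕ) : Type where
  isEq : Bool
  lhs : Term n
  rhs : Term n
  deriving DecidableEq

def Term.eval {n : ℕ} (x : Inst n) : Term n → Bool
  | .const b => b
  | .var i => x i

/-- Satisfaction of a literal by an instance. -/
def Lit.sat {n : ℕ} (x : Inst n) (ℓ : Lit n) : Prop :=
  if ℓ.isEq then ℓ.lhs.eval x = ℓ.rhs.eval x else ℓ.lhs.eval x ≠ ℓ.rhs.eval x

/-- A condition: a finite conjunction of literals. -/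
abbrev Cond (n : ℕ) := List (Lit n)

/-- Models of a condition. -/
def Mods {n : ℕ} (φ : Cond n) : Set (Inst n) := {x | ∀ ℓ ∈ φ, ℓ.sat x}

/-- Models of a single literal. -/
def ModsL {n : ℕ} (ℓ : Lit n) : Set (Inst n) := {x | ℓ.sat x}

/-- Instances classified with class c by classifier M. -/
def ModsM {n : ℕ} (M : Inst n → Bool) (c : Bool) : Set (Inst n) := {x | M x = c}

/-- A condition entails a literal. -/
def Entails {n : ℕ} (φ : Cond n) (ℓ : Lit n) : Prop := Mods φ ⊆ ModsL ℓ

/-- φ is a global necessary reason for class c w.r.t. classifier M. -/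
def GNR {n : ℕ} (M : Inst n → Bool) (c : Bool) (φ : Cond n) : Prop :=
  ModsM M c ⊆ Mods φ

theorem mods_cons {n : ℕ} (ℓ : Lit n) (φ : Cond n) : Mods (ℓ :: φ) = ModsL ℓ ∩ Mods φ := by
  ext x
  simp [Mods, ModsL]

theorem gnr_iff_forall_singleton {n : ℕ} {M : Inst n → Bool} {c : Bool} {φ : Cond n} :
    GNR M c φ ↔ ∀ ℓ ∈ φ, GNR M c [ℓ] := by
  simp only [GNR, Mods, Set.subset_def, Set.mem_ofPred_eq, List.mem_singleton, forall_eq]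
  exact ⟨fun h ℓ hℓ x hx => h x hx ℓ hℓ, fun h x hx ℓ hℓ => h ℓ hℓ x hx⟩

/-- A ⊆-minimal-violating witness characterization:
a global necessary reason φ is not ⊆-minimal iff some literal ℓ not entailed by φ
is itself a global necessary reason. -/
theorem stmt0 {n : ℕ} (hn : 1 ≤ n) (M : Inst n → Bool) (c : Bool) (φ : Cond n)
    (hφ : GNR M c φ) :
    (∃ ψ : Cond n, GNR M c ψ ∧ Mods ψ ⊂ Mods φ) ↔
      ∃ ℓ : Lit n, ¬ Entails φ ℓ ∧ GNR M c [ℓ] := by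
  constructor
  · rintro ⟨ψ, hψ, hlt⟩
    obtain ⟨x, hxφ, hxψ⟩ := Set.exists_of_ssubset hlt
    obtain ⟨ℓ, hℓ, hx⟩ : ∃ ℓ ∈ ψ, ¬ ℓ.sat x := by simpa [Mods] using hxψ
    exact ⟨ℓ, fun h => hx (h hxφ), gnr_iff_forall_singleton.1 hψ ℓ hℓ⟩
  · rintro ⟨ℓ, hent, hℓ⟩
    refine ⟨ℓ :: φ, gnr_iff_forall_singleton.2 ?_, ?_⟩
    · exact List.forall_mem_cons.2 ⟨hℓ, gnr_iff_forall_singleton.1 hφ⟩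
    · rw [mods_cons]
      exact ⟨Set.inter_subset_right, fun h => hent fun x hx => (h hx).1⟩
end

section
/- Let M be an n-feature classifier, c ∈ {0,1} a class, and φ ∈ L_n a global necessary reason for c w.r.t. M. Then φ is not ≤-minimal (cardinality-minimal) if and only if there exists a literal ℓ over n features such that φ ⊭ ℓ and ℓ (viewed as a one-literal condition) is a global necessary reason for c w.r.t. M. -/
/-- A ≤-minimal-violating witness characterization:
a global necessary reason φ is not ≤-minimal (cardinality-minimal) iff some literal ℓ
not entailed by φ is itself a global necessary reason. -/
theorem stmt1 {n : ℕ} (hn : 1 ≤ n) (M : Inst n → Bool) (c : Bool) (φ : Cond n)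
    (hφ : GNR M c φ) :
    (∃ ψ : Cond n, GNR M c ψ ∧ (Mods ψ).ncard < (Mods φ).ncard) ↔
      ∃ ℓ : Lit n, ¬ Entails φ ℓ ∧ GNR M c [ℓ] := by
  constructor
  · rintro ⟨ψ, hψ, hlt⟩
    by_contra! h
    refine absurd (Set.ncard_le_ncard (fun x hx ℓ hℓ => ?_) (Set.toFinite (Mods ψ))) hlt.not_ge
    by_contra hsat
    refine h ℓ (fun hent => hsat (hent hx)) fun y hy ℓ' hℓ' => ?_
    rw [List.mem_singleton.mp hℓ']
    exact hψ hy ℓ hℓ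
  · rintro ⟨ℓ, hent, hℓ⟩
    obtain ⟨x, hx, hxℓ⟩ := Set.not_subset.mp hent
    refine ⟨ℓ :: φ, fun y hy => ?_, Set.ncard_lt_ncard ⟨fun y hy ℓ' hℓ' => ?_, fun hsub => ?_⟩⟩
    · exact List.forall_mem_cons.mpr ⟨hℓ hy ℓ (List.mem_singleton_self ℓ), hφ hy⟩
    · exact hy ℓ' (List.mem_cons_of_mem ℓ hℓ')
    · exact hxℓ (hsub hx ℓ List.mem_cons_self)
end

section
/- Let M be an n-feature classifier, c ∈ {0,1} a class, and φ ∈ L_n a global necessary reason for c w.r.t. M. Then φ is ≤-minimal (cardinality-minimal) if and only if φ is ⊆-minimal (model-subset-minimal). -/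
theorem Mods_append {n : ℕ} (φ ψ : Cond n) : Mods (φ ++ ψ) = Mods φ ∩ Mods ψ := by
  ext x
  simp only [Mods, List.mem_append, Set.mem_inter_iff, Set.mem_ofPred_eq, or_imp, forall_and]

/-- For a global necessary reason φ, ≤-minimality and ⊆-minimality coincide. -/
theorem stmt2 {n : ℕ} (hn : 1 ≤ n) (M : Inst n → Bool) (c : Bool) (φ : Cond n)
    (hφ : GNR M c φ) :
    (¬ ∃ ψ : Cond n, GNR M c ψ ∧ (Mods ψ).ncard < (Mods φ).ncard) ↔
      (¬ ∃ ψ : Cond n, GNR M c ψ ∧ Mods ψ ⊂ Mods φ) := by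
  refine not_congr ⟨?_, ?_⟩
  · rintro ⟨ψ, hψ, hlt⟩
    refine ⟨φ ++ ψ, ?_, ?_⟩
    · rw [GNR, Mods_append]
      exact Set.subset_inter hφ hψ
    · rw [Mods_append]
      refine ⟨Set.inter_subset_left, fun h => hlt.not_ge ?_⟩
      exact Set.ncard_le_ncard (h.trans Set.inter_subset_right) (Set.toFinite _)
  · rintro ⟨ψ, hψ, hss⟩
    exact ⟨ψ, hψ, Set.ncard_lt_ncard hss (Set.toFinite _)⟩
end

section
/- Let M be an n-feature classifier and c ∈ {0,1} a class. If φ, ψ ∈ L_n are both ⊆-minimal global necessary reasons for c w.r.t. M, then Mod(φ) = Mod(ψ). -/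
theorem GNR.append {n : ℕ} {M : Inst n → Bool} {c : Bool} {φ ψ : Cond n}
    (hφ : GNR M c φ) (hψ : GNR M c ψ) : GNR M c (φ ++ ψ) := by
  rw [GNR, Mods_append]
  exact Set.subset_inter hφ hψ

/-- A ⊆-minimal global necessary reason entails every global necessary reason. -/
theorem GNR.Mods_subset_of_minimal {n : ℕ} {M : Inst n → Bool} {c : Bool} {φ ψ : Cond n}
    (hφ : GNR M c φ) (hψ : GNR M c ψ)
    (hφmin : ¬ ∃ χ : Cond n, GNR M c χ ∧ Mods χ ⊂ Mods φ) : Mods φ ⊆ Mods ψ := by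
  by_contra h
  refine hφmin ⟨φ ++ ψ, hφ.append hψ, ?_⟩
  rw [Mods_append]
  exact ⟨Set.inter_subset_left, fun h' => h fun x hx => (h' hx).2⟩

/-- Any two ⊆-minimal global necessary reasons have the same models. -/
theorem stmt6 {n : ℕ} (hn : 1 ≤ n) (M : Inst n → Bool) (c : Bool) (φ ψ : Cond n)
    (hφ : GNR M c φ) (hψ : GNR M c ψ)
    (hφmin : ¬ ∃ χ : Cond n, GNR M c χ ∧ Mods χ ⊂ Mods φ)
    (hψmin : ¬ ∃ χ : Cond n, GNR M c χ ∧ Mods χ ⊂ Mods ψ) :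
    Mods φ = Mods ψ := by
  exact (hφ.Mods_subset_of_minimal hψ hφmin).antisymm (hψ.Mods_subset_of_minimal hφ hψmin)
end

section
/- Let w ∈ ℚ^n, b ∈ ℚ, and let i ≠ j be indices in {1, …, n}. Define x̂ ∈ {0,1}^n by: x̂_k = 1 if w_k ≥ 0 and x̂_k = 0 otherwise, for every k ∉ {i, j}; and x̂_i = x̂_j = 1 if w_i + w_j ≥ 0, x̂_i = x̂_j = 0 otherwise. Then there exists x ∈ {0,1}^n with x_i = x_j and x·w + b ≥ 0 if and only if x̂·w + b ≥ 0. -/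
/-- Dot product of a binary vector (regarded as a rational vector) with w ∈ ℚ^n. -/
def dotB {n : ℕ} (x : Fin n → Bool) (w : Fin n → ℚ) : ℚ :=
  ∑ i, if x i then w i else 0

theorem dotB_eq_add_add_sum {n : ℕ} (x : Fin n → Bool) (w : Fin n → ℚ) {i j : Fin n}
    (hij : i ≠ j) :
    dotB x w = (if x i then w i else 0) + ((if x j then w j else 0) +
      ∑ k ∈ (Finset.univ.erase i).erase j, if x k then w k else 0) := by
  rw [dotB, Finset.add_sum_erase _ (fun k => if x k then w k else 0) (by simp [hij.symm]),
    Finset.add_sum_erase _ (fun k => if x k then w k else 0) (Finset.mem_univ i)]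

/-- Satisfiability of x·w + b ≥ 0 under the constraint x_i = x_j is witnessed by the
canonical candidate x̂. -/
theorem stmt13 {n : ℕ} (hn : 1 ≤ n) (w : Fin n → ℚ) (b : ℚ) (i j : Fin n) (hij : i ≠ j) :
    (∃ x : Fin n → Bool, x i = x j ∧ 0 ≤ dotB x w + b) ↔
      0 ≤ dotB (fun k => if k = i ∨ k = j then decide (0 ≤ w i + w j)
                         else decide (0 ≤ w k)) w + b := by
  refine ⟨?_, fun h => ⟨_, by simp, h⟩⟩
  rintro ⟨x, hx, h⟩
  refine h.trans (add_le_add_left ?_ b)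
  rw [dotB_eq_add_add_sum _ _ hij, dotB_eq_add_add_sum _ _ hij, ← add_assoc, ← add_assoc]
  refine add_le_add ?_ (Finset.sum_le_sum fun k hk => ?_)
  · simp only [hx, true_or, or_true, if_true, decide_eq_true_eq]
    split_ifs <;> linarith
  · simp only [Finset.mem_erase] at hk
    simp only [hk.1, hk.2.1, or_self, if_false, decide_eq_true_eq]
    split_ifs <;> linarith
end

section
/- Let M be an n-feature classifier, c ∈ {0,1} a class, and Π a finite family of conditions in L_n such that Mod(M,c) = ⋃_{ψ ∈ Π} Mod(ψ). Then a condition φ ∈ L_n is not a global necessary reason for c w.r.t. M if and only if there exist ψ ∈ Π and a literal ℓ over n features such that ψ ⊭ ℓ and φ ⊨ ℓ. (For a free binary decision diagram B and class c, this hypothesis holds with Π the set of path-conditions φ_π of the paths π from the root of B to its c-labeled sinks.) -/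
/-- If Mods(M,c) is a finite union of condition model-sets (e.g. the path-conditions of a
free BDD), then φ fails to be a global necessary reason iff some member ψ of the family
and some literal ℓ satisfy ψ ⊭ ℓ and φ ⊨ ℓ. -/
theorem stmt15 {n : ℕ} (hn : 1 ≤ n) (M : Inst n → Bool) (c : Bool)
    (Ps : Finset (Cond n)) (hPs : ModsM M c = ⋃ ψ ∈ Ps, Mods ψ) (φ : Cond n) :
    ¬ GNR M c φ ↔ ∃ ψ ∈ Ps, ∃ ℓ : Lit n, ¬ Entails ψ ℓ ∧ Entails φ ℓ := by
  constructor
  · intro h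
    obtain ⟨x, hxM, hxφ⟩ := Set.not_subset.mp h
    rw [hPs] at hxM
    obtain ⟨ψ, hψ, hxψ⟩ := Set.mem_iUnion₂.mp hxM
    have hx : ¬ ∀ ℓ ∈ φ, ℓ.sat x := hxφ
    push Not at hx
    obtain ⟨ℓ, hℓ, hxℓ⟩ := hx
    exact ⟨ψ, hψ, ℓ, fun hE => hxℓ (hE hxψ), fun y hy => hy ℓ hℓ⟩
  · rintro ⟨ψ, hψ, ℓ, hψℓ, hφℓ⟩ hG
    refine hψℓ fun x hx => hφℓ (hG ?_)
    rw [hPs]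
    exact Set.mem_iUnion₂.mpr ⟨ψ, hψ, hx⟩
end

section
/- Let p, q ≥ 1, let γ : {0,1}^p → {0,1} and δ : {0,1}^q → {0,1}, and let M be the (p+q+2)-feature classifier defined on instances z = (x, y, g, d) with x ∈ {0,1}^p, y ∈ {0,1}^q, g, d ∈ {0,1} (g being feature p+q+1 and d being feature p+q+2) by M(z) = 1 iff (γ(x) = 1 or g = 1) and (δ(y) = 1 or d = 1). If γ is satisfiable (there exists x with γ(x) = 1) and δ is unsatisfiable (δ(y) = 0 for all y), then the one-literal condition (v_{p+q+2} = 1) is a global necessary reason for class 1 w.r.t. M which is both ⊆-minimal and ≤-minimal. -/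
/-- The classifier z = (x, y, g, d) ↦ (γ(x) ∨ g) ∧ (δ(y) ∨ d), where x are the first p
features, y the next q features, g is feature p+q+1 and d is feature p+q+2. -/
def mkM (p q : ℕ) (γ : (Fin p → Bool) → Bool) (δ : (Fin q → Bool) → Bool) :
    Inst (p + q + 2) → Bool := fun z =>
  ((γ (fun i => z (Fin.castLE (by omega) i)) || z ⟨p + q, by omega⟩) &&
   (δ (fun j => z (Fin.castLE (by omega) (Fin.natAdd p j))) || z ⟨p + q + 1, by omega⟩))

/-- The literal (v_{p+q+2} = 1). -/
def dLit (p q : ℕ) : Lit (p + q + 2) :=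
  ⟨true, Term.var ⟨p + q + 1, by omega⟩, Term.const true⟩

/-- The literal (v_{p+q+1} = 1). -/
def gLit (p q : ℕ) : Lit (p + q + 2) :=
  ⟨true, Term.var ⟨p + q, by omega⟩, Term.const true⟩

/-- A literal that holds whenever `v_G = v_D = 1`, and at some point with `v_G = 0` and `v_D = 1`,
holds whenever `v_D = 1`. -/
theorem Lit.sat_of_sat_of_exists {n : ℕ} {G D : Fin n} (hGD : G ≠ D) (ℓ : Lit n)
    (h : ∀ z : Inst n, z G = true → z D = true → ℓ.sat z)
    {w : Inst n} (hwG : w G = false) (hwD : w D = true) (hw : ℓ.sat w)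
    {z : Inst n} (hzD : z D = true) : ℓ.sat z := by
  cases hzG : z G with
  | true => exact h z hzG hzD
  | false =>
    have hz := h (Function.update z G true) (by simp) (by simp [hGD.symm, hzD])
    have ht := h (fun _ => true) rfl rfl
    have hf : ∀ i, i ≠ G → i ≠ D → ℓ.sat (Function.update (fun _ => true) i false) :=
      fun i hiG hiD => h _ (by simp [hiG.symm]) (by simp [hiD.symm])
    clear h
    obtain ⟨e, _ | i, _ | j⟩ := ℓ
    case false.var.var =>
      have hi := hf i
      have hj := hf j
      clear hf
      cases e <;> simp only [Lit.sat, Term.eval, Function.update_apply] at * <;> grind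
    all_goals
      clear hf
      cases e <;> simp only [Lit.sat, Term.eval, Function.update_apply] at * <;> grind

/-- If `γ` is satisfiable, every necessary reason for class 1 is entailed by `v_{p+q+2} = 1`. -/
theorem Mods_dLit_subset_of_GNR {p q : ℕ}
    {γ : (Fin p → Bool) → Bool} {δ : (Fin q → Bool) → Bool} (hγ : ∃ x, γ x = true)
    {ψ : Cond (p + q + 2)} (hψ : GNR (mkM p q γ δ) true ψ) :
    Mods [dLit p q] ⊆ Mods ψ := by
  obtain ⟨x, hx⟩ := hγ
  intro z hz ℓ hℓ
  have hzD : z ⟨p + q + 1, by omega⟩ = true := by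
    simpa [Mods, dLit, Lit.sat, Term.eval] using hz
  let w : Inst (p + q + 2) := fun i =>
    if hi : i.val < p then x ⟨i, hi⟩ else decide (i.val = p + q + 1)
  have hwG : w ⟨p + q, by omega⟩ = false := by simp [w]
  have hwD : w ⟨p + q + 1, by omega⟩ = true := by
    have : ¬ p + q + 1 < p := by omega
    simp [w, this]
  have hwx : (fun i : Fin p => w (Fin.castLE (by omega) i)) = x := by
    funext i
    simp [w]
  refine Lit.sat_of_sat_of_exists (G := ⟨p + q, by omega⟩) (by simp) ℓ
    (fun u huG huD => hψ ?_ ℓ hℓ) hwG hwD (hψ ?_ ℓ hℓ) hzD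
  · simp [ModsM, mkM, huG, huD]
  · simp [ModsM, mkM, hwD, hwx, hx]

/-- If γ is satisfiable and δ is unsatisfiable, then (v_{p+q+2} = 1) is a global
necessary reason for class 1 w.r.t. M, and it is both ⊆-minimal and ≤-minimal. -/
theorem stmt16 (p q : ℕ) (hp : 1 ≤ p) (hq : 1 ≤ q)
    (γ : (Fin p → Bool) → Bool) (δ : (Fin q → Bool) → Bool)
    (hγ : ∃ x, γ x = true) (hδ : ∀ y, δ y = false) :
    GNR (mkM p q γ δ) true [dLit p q] ∧
    (¬ ∃ ψ : Cond (p + q + 2), GNR (mkM p q γ δ) true ψ ∧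
        Mods ψ ⊂ Mods [dLit p q]) ∧
    (¬ ∃ ψ : Cond (p + q + 2), GNR (mkM p q γ δ) true ψ ∧
        (Mods ψ).ncard < (Mods [dLit p q]).ncard) := by
  refine ⟨fun z hz => ?_, ?_, ?_⟩
  · have h : mkM p q γ δ z = true := hz
    simp only [mkM, hδ, Bool.false_or, Bool.and_eq_true] at h
    simpa [Mods, dLit, Lit.sat, Term.eval] using h.2
  · rintro ⟨ψ, hψ, hlt⟩
    exact hlt.2 (Mods_dLit_subset_of_GNR hγ hψ)
  · rintro ⟨ψ, hψ, hlt⟩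
    exact hlt.not_ge (Set.ncard_le_ncard (Mods_dLit_subset_of_GNR hγ hψ) (Set.toFinite _))
end
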